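/- Let C be an [lm, K] quasi-cyclic code over F_q which is a linear code over R_m ε_t, where the primitive idempotent ε_t corresponds to the q-cyclotomic coset {i_t, i_t q, …, i_t q^{k−1}} modulo m. Then for each positive divisor r of m, the number of nonzero codewords c ∈ C \ {0} satisfying ρ^{rl}(c) = c is equal to q^K − 1 if (m/r) divides i_t, and is equal to 0 otherwise. -/

import Mathlib

/-- The shift `ρ^l` on `F^{lm}`, with a codeword indexed as `c (i, j) = c_{ij}`
(`i ∈ ZMod m` the block index, `j ∈ Fin l` the position inside a block):
`(ρ^l c) (i, j) = c (i - 1, j)`. -/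
noncomputable def shiftQC (F : Type*) [Field F] (m l : ℕ) :
    ((ZMod m × Fin l) → F) ≃ₗ[F] ((ZMod m × Fin l) → F) :=
  LinearEquiv.funCongrLeft F F ((Equiv.subRight (1 : ZMod m)).prodCongr (Equiv.refl (Fin l)))

/-- The `q`-cyclotomic coset of `i_t` modulo `m`, viewed inside `ZMod m`. -/
def cycCoset (q m it : ℕ) : Set (ZMod m) :=
  {j | ∃ r : ℕ, j = (it : ZMod m) * (q : ZMod m) ^ r}

/-- Evaluation of the polynomial `Σ_i c_i x^i ∈ R_m = F[x]/(x^m - 1)` at `ζ^j`, computed in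
an extension field `E` of `F` containing the primitive `m`-th root of unity `ζ`. -/
noncomputable def evalDFT {F E : Type*} [Field F] [Field E] [Algebra F E] {m : ℕ} [NeZero m]
    (ζ : E) (c : ZMod m → F) (j : ZMod m) : E :=
  ∑ i : ZMod m, algebraMap F E (c i) * ζ ^ (i * j).val

/-- `Σ_i c_i x^i` lies in the minimal ideal `R_m ε_t` of `R_m` associated with the
`q`-cyclotomic coset of `i_t`, i.e. it vanishes at `ζ^j` for every `j` outside the coset. -/
def inMinIdeal {F E : Type*} [Field F] [Field E] [Algebra F E] (q : ℕ) {m : ℕ} [NeZero m]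
    (ζ : E) (it : ℕ) (c : ZMod m → F) : Prop :=
  ∀ j : ZMod m, j ∉ cycCoset q m it → evalDFT ζ c j = 0

/-- A vector over `F` indexed by `ZMod m` is determined by its values at the powers of `ζ`. -/
theorem eq_zero_of_forall_evalDFT_eq_zero {F E : Type*} [Field F] [Field E] [Algebra F E]
    {m : ℕ} [NeZero m] {ζ : E} (hζ : IsPrimitiveRoot ζ m) {c : ZMod m → F}
    (h : ∀ j, evalDFT ζ c j = 0) : c = 0 := by
  have hψ := AddChar.zmodChar_primitive_of_primitive_root m hζ
  have hinj := AddChar.to_mulShift_inj_of_isPrimitive hψ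
  set ψ := AddChar.zmodChar m hζ.pow_eq_one
  have hli : LinearIndependent E
      (fun i : ZMod m => ((ψ.mulShift i).toMonoidHom : Multiplicative (ZMod m) → E)) :=
    (linearIndependent_monoidHom (Multiplicative (ZMod m)) E).comp
      (fun i => (ψ.mulShift i).toMonoidHom)
      fun _ _ hab => hinj (AddChar.toMonoidHomEquiv.injective hab)
  funext i
  refine (map_eq_zero (algebraMap F E)).1
    (Fintype.linearIndependent_iff.1 hli (fun i => algebraMap F E (c i)) ?_ i)
  funext j
  rw [Finset.sum_apply]
  exact h j.toAdd

theorem shiftQC_apply {F : Type*} [Field F] {m l : ℕ} (c : (ZMod m × Fin l) → F)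
    (i : ZMod m) (v : Fin l) : shiftQC F m l c (i, v) = c (i - 1, v) :=
  rfl

theorem shiftQC_pow_apply {F : Type*} [Field F] {m l : ℕ} (r : ℕ) (c : (ZMod m × Fin l) → F)
    (i : ZMod m) (v : Fin l) : (shiftQC F m l ^ r) c (i, v) = c (i - r, v) := by
  induction r generalizing i with
  | zero => simp
  | succ r ih =>
    rw [pow_succ', LinearEquiv.mul_apply, shiftQC_apply, ih, Nat.cast_succ, sub_sub, add_comm]

theorem evalDFT_sub {F E : Type*} [Field F] [Field E] [Algebra F E] {m : ℕ} [NeZero m]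
    (ζ : E) (c d : ZMod m → F) (j : ZMod m) :
    evalDFT ζ (fun i => c i - d i) j = evalDFT ζ c j - evalDFT ζ d j := by
  simp [evalDFT, sub_mul]

/-- Shifting by `a` multiplies the value at `ζ ^ j` by `ζ ^ (a * j)`. -/
theorem evalDFT_shift {F E : Type*} [Field F] [Field E] [Algebra F E] {m : ℕ} [NeZero m]
    {ζ : E} (hζ : ζ ^ m = 1) (c : ZMod m → F) (a j : ZMod m) :
    evalDFT ζ (fun i => c (i - a)) j = ζ ^ (a * j).val * evalDFT ζ c j := by
  simp only [evalDFT, ← AddChar.zmodChar_apply hζ, Finset.mul_sum]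
  rw [← Equiv.sum_comp (Equiv.addRight a)]
  refine Finset.sum_congr rfl fun i _ => ?_
  simp only [Equiv.coe_addRight, add_sub_cancel_right, add_mul, AddChar.map_add_eq_mul]
  ring

theorem natCast_mul_eq_zero_iff_of_mem_cycCoset {q m it r : ℕ} (hco : m.Coprime q)
    (hr : r ∣ m) (hrpos : 0 < r) {j : ZMod m} (hj : j ∈ cycCoset q m it) :
    (r : ZMod m) * j = 0 ↔ m / r ∣ it := by
  obtain ⟨s, rfl⟩ := hj
  have hq : IsUnit ((q : ZMod m) ^ s) := ((ZMod.isUnit_iff_coprime q m).2 hco.symm).pow s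
  rw [← mul_assoc, hq.mul_left_eq_zero, ← Nat.cast_mul, ZMod.natCast_eq_zero_iff]
  obtain ⟨n, rfl⟩ := hr
  rw [Nat.mul_div_cancel_left n hrpos, Nat.mul_dvd_mul_iff_left hrpos]

/-- A tuple of elements of `R_m ε_t` is fixed by `ρ^{rl}` exactly when it is zero or
`m / r` divides `i_t`. -/
theorem shiftQC_pow_eq_self_iff {F E : Type*} [Field F] [Field E] [Algebra F E]
    {q m l it r : ℕ} [NeZero m] (hco : m.Coprime q) {ζ : E} (hζ : IsPrimitiveRoot ζ m)
    (hr : r ∣ m) (hrpos : 0 < r) {c : (ZMod m × Fin l) → F}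
    (hc : ∀ v : Fin l, inMinIdeal q ζ it (fun i : ZMod m => c (i, v))) :
    (shiftQC F m l ^ r) c = c ↔ c = 0 ∨ m / r ∣ it := by
  have hshift (v : Fin l) (j : ZMod m) :
      evalDFT ζ (fun i => (shiftQC F m l ^ r) c (i, v)) j =
        ζ ^ ((r : ZMod m) * j).val * evalDFT ζ (fun i => c (i, v)) j := by
    simp only [shiftQC_pow_apply]
    exact evalDFT_shift hζ.pow_eq_one (fun i => c (i, v)) r j
  constructor
  · intro hfix
    by_contra! hne
    refine hne.1 (funext fun ⟨i, v⟩ => ?_)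
    refine congrFun (eq_zero_of_forall_evalDFT_eq_zero hζ (c := fun i => c (i, v))
      fun j => ?_) i
    by_cases hj : j ∈ cycCoset q m it
    · have h := hshift v j
      rw [hfix] at h
      by_contra h0
      have h1 : ζ ^ ((r : ZMod m) * j).val = 1 := (right_eq_mul₀ h0).1 h
      refine hne.2 ((natCast_mul_eq_zero_iff_of_mem_cycCoset hco hr hrpos hj).1 ?_)
      exact (ZMod.val_eq_zero _).1
        (Nat.eq_zero_of_dvd_of_lt (hζ.dvd_of_pow_eq_one _ h1) (ZMod.val_lt _))
    · exact hc v j hj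
  · rintro (rfl | hdvd)
    · exact map_zero _
    · funext ⟨i, v⟩
      refine sub_eq_zero.1 (congrFun (eq_zero_of_forall_evalDFT_eq_zero hζ
        (c := fun i => (shiftQC F m l ^ r) c (i, v) - c (i, v)) fun j => ?_) i)
      rw [evalDFT_sub, hshift]
      by_cases hj : j ∈ cycCoset q m it
      · rw [(natCast_mul_eq_zero_iff_of_mem_cycCoset hco hr hrpos hj).2 hdvd]
        simp
      · rw [hc v j hj, mul_zero, sub_zero]

/-- Let `C` be an `[lm, K]` quasi-cyclic code over `F_q` which is a linear
code over `R_m ε_t`, the primitive idempotent `ε_t` corresponding to the `q`-cyclotomic coset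
`{i_t, i_t q, …, i_t q^{k-1}}` modulo `m`.  Then for every positive divisor `r` of `m`, the
number of nonzero codewords fixed by `ρ^{rl}` is `q^K - 1` if `(m/r) ∣ i_t` and `0`
otherwise. -/
theorem fixed_points_shift_minimal_ideal {F E : Type*} [Field F] [Fintype F] [DecidableEq F]
    [Field E] [Algebra F E] {m l K k it : ℕ} [NeZero m] (hl : 2 ≤ l)
    (hco : Nat.Coprime m (Fintype.card F))
    (ζ : E) (hζ : IsPrimitiveRoot ζ m)
    (C : Submodule F ((ZMod m × Fin l) → F))
    (hQC : ∀ c ∈ C, shiftQC F m l c ∈ C)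
    (hmin : ∀ c ∈ C, ∀ v : Fin l,
      inMinIdeal (Fintype.card F) ζ it (fun i : ZMod m => c (i, v)))
    (hK : Module.finrank F ↥C = K)
    (hk : (cycCoset (Fintype.card F) m it).ncard = k)
    {r : ℕ} (hr : r ∣ m) (hrpos : 0 < r) :
    Set.ncard {c : (ZMod m × Fin l) → F | c ∈ C ∧ c ≠ 0 ∧ (shiftQC F m l ^ r) c = c} =
      if (m / r) ∣ it then Fintype.card F ^ K - 1 else 0 := by
  have hfix (c) (hc : c ∈ C) := shiftQC_pow_eq_self_iff hco hζ hr hrpos (hmin c hc)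
  split_ifs with hdvd
  · have hset : {c | c ∈ C ∧ c ≠ 0 ∧ (shiftQC F m l ^ r) c = c} =
        (C : Set ((ZMod m × Fin l) → F)) \ {0} := by
      ext c
      simp only [Set.mem_ofPred_eq, Set.mem_sdiff, SetLike.mem_coe, Set.mem_singleton_iff]
      exact ⟨fun h => ⟨h.1, h.2.1⟩, fun h => ⟨h.1, h.2, (hfix c h.1).2 (Or.inr hdvd)⟩⟩
    rw [hset, Set.ncard_sdiff_singleton_of_mem C.zero_mem, ← Nat.card_coe_set_eq,
      SetLike.coe_sort_coe, Module.natCard_eq_pow_finrank (K := F), hK, Nat.card_eq_fintype_card]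
  · rw [Set.ncard_eq_zero]
    refine Set.eq_empty_of_forall_notMem fun c hc => ?_
    exact ((hfix c hc.1).1 hc.2.2).elim hc.2.1 hdvd
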